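/- For all integers s ≥ 3 and ρ with s−1 ≤ ρ ≤ s²−s−3, there is no bipartite graph G with parts V₁ and V₂ such that |V₁| = s²−1, |V₂| = ρ(s²−1), every vertex of V₁ has degree ρs, every vertex of V₂ has degree s, and G has diameter 3. In other words, no [ρs,s;3]-bigraph attains the Moore bound M(ρs,s;3) = (s²−1)(ρ+1). -/

import Mathlib

open Finset in
/-- In a regular intersecting `s`-uniform family on `n` points, `(s - 1) n ≤ (n + 1) (s² - n)`. -/
theorem regular_intersecting_card_bound {α β : Type*} [Fintype α] [Fintype β] [DecidableEq α]
    [Nonempty β] (f : β → Finset α) (s d : ℕ) (hcard : ∀ b, (f b).card = s)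
    (hdeg : ∀ a, #{b | a ∈ f b} = d) (hint : ∀ b b', (f b ∩ f b').Nonempty) :
    ((s : ℝ) - 1) * Fintype.card α ≤
      (Fintype.card α + 1) * ((s : ℝ) ^ 2 - Fintype.card α) := by
  set n := Fintype.card α
  set m := Fintype.card β with hm
  have hm0 : (0 : ℝ) < m := by exact_mod_cast Fintype.card_pos
  have hn0 : (0 : ℝ) < n := by
    obtain ⟨a, -⟩ := hint (Classical.arbitrary β) (Classical.arbitrary β)
    exact_mod_cast Fintype.card_pos_iff.mpr ⟨a⟩
  have hcount : (n : ℝ) * d = m * s := by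
    have := sum_card_bipartiteAbove_eq_sum_card_bipartiteBelow
      (s := (univ : Finset α)) (t := (univ : Finset β)) (fun a b => a ∈ f b)
    simp only [bipartiteAbove, bipartiteBelow, hdeg, filter_univ_mem, hcard, sum_const,
      card_univ, smul_eq_mul] at this
    exact_mod_cast this
  let χ : β → α → ℝ := fun b a => if a ∈ f b then 1 else 0
  have hmem : (fun _ => (s : ℝ) / n : α → ℝ) ∈ convexHull ℝ (Set.range χ) := by
    have h := (convex_convexHull ℝ (Set.range χ)).sum_mem (t := univ)
      (w := fun _ => (m : ℝ)⁻¹) (z := χ) (fun _ _ => by positivity)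
      (by simp [← hm, hm0.ne']) (fun b _ => subset_convexHull ℝ _ ⟨b, rfl⟩)
    convert h using 1
    funext a
    simp only [Finset.sum_apply, Pi.smul_apply, smul_eq_mul, ← mul_sum, χ, sum_boole, hdeg]
    field_simp
    linarith
  obtain ⟨ι, _, z, w, hz, haff, hw, hw1, hsum⟩ := eq_pos_convex_span_of_mem_convexHull hmem
  have hι : (Fintype.card ι : ℝ) ≤ n + 1 := by
    have h1 := haff.card_le_finrank_succ
    have h2 := Submodule.finrank_le (vectorSpan ℝ (Set.range z))
    rw [Module.finrank_fintype_fun_eq_card] at h2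
    exact_mod_cast h1.trans (Nat.succ_le_succ h2)
  choose g hg using fun i => hz ⟨i, rfl⟩
  have hinner : ∀ i j, ∑ a ∈ f (g j), z i a = #(f (g j) ∩ f (g i)) := by
    intro i j
    rw [← hg i]
    simp [χ]
  have hweight : ∀ j, 1 + ((s : ℝ) - 1) * w j ≤ (s : ℝ) ^ 2 / n := by
    intro j
    have h1 : ∑ a ∈ f (g j), ∑ i, w i * z i a = (s : ℝ) ^ 2 / n := by
      have : ∀ a, ∑ i, w i * z i a = (s : ℝ) / n := fun a => by
        simpa using congrFun hsum a
      simp only [this, sum_const, hcard, nsmul_eq_mul]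
      ring
    rw [← h1, sum_comm]
    simp only [← mul_sum, hinner]
    classical
    calc 1 + ((s : ℝ) - 1) * w j
        = ∑ i, (w i + if i = j then ((s : ℝ) - 1) * w i else 0) := by
          simp [sum_add_distrib, hw1]
      _ ≤ _ := by
          refine sum_le_sum fun i _ => ?_
          split_ifs with h
          · subst h
            rw [inter_self, hcard]
            linarith
          · have : (1 : ℝ) ≤ #(f (g j) ∩ f (g i)) := by
              exact_mod_cast (hint (g j) (g i)).card_pos
            nlinarith [hw i]
  have htotal : (s : ℝ) - 1 ≤ Fintype.card ι * ((s : ℝ) ^ 2 / n - 1) := by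
    have h := sum_le_sum fun j (_ : j ∈ univ) => hweight j
    simp only [sum_add_distrib, ← mul_sum, hw1, sum_const, card_univ, nsmul_eq_mul] at h
    linarith
  have hnonneg : 0 ≤ (s : ℝ) ^ 2 / n - 1 := by
    obtain ⟨a, ha⟩ := hint (Classical.arbitrary β) (Classical.arbitrary β)
    have hs1 : (1 : ℝ) ≤ s := by
      rw [← hcard (Classical.arbitrary β)]
      exact_mod_cast card_pos.mpr ⟨a, (mem_inter.mp ha).1⟩
    obtain ⟨j⟩ : Nonempty ι := by
      by_contra h
      rw [not_nonempty_iff] at h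
      simp at hw1
    nlinarith [hweight j, mul_nonneg (sub_nonneg.mpr hs1) (hw j).le]
  have hfinal := mul_le_mul_of_nonneg_right (htotal.trans
    (mul_le_mul_of_nonneg_right hι hnonneg)) hn0.le
  calc _ ≤ _ := hfinal
    _ = _ := by field_simp

/-- In a bipartite graph of diameter `3`, distinct vertices of a part have a common neighbour. -/
theorem exists_common_neighbor_of_diam_eq_three {V : Type*} (G : SimpleGraph V)
    (V1 V2 : Finset V) (hpart : ∀ v : V, v ∈ V1 ↔ v ∉ V2)
    (hbip : ∀ u v : V, G.Adj u v → (u ∈ V1 ∧ v ∈ V2) ∨ (u ∈ V2 ∧ v ∈ V1))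
    (hdiam : G.diam = 3) {u v : V} (hu : u ∈ V2) (hv : v ∈ V2) (huv : u ≠ v) :
    ∃ x, G.Adj u x ∧ G.Adj v x := by
  have htop : G.ediam ≠ ⊤ := by
    intro h
    simp [SimpleGraph.diam, h] at hdiam
  have : Nonempty V := ⟨u⟩
  obtain ⟨p, hp⟩ := (SimpleGraph.connected_of_ediam_ne_top htop).exists_walk_length_eq_dist u v
  have hle : p.length ≤ 3 := by
    rw [hp, ← hdiam]
    exact SimpleGraph.dist_le_diam htop
  have hcross : ∀ {a b}, G.Adj a b → (a ∈ V2 ↔ b ∉ V2) := fun {a b} h => by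
    have := hbip a b h
    have := hpart a
    have := hpart b
    tauto
  match p, hle with
  | .nil, _ => exact absurd rfl huv
  | .cons h .nil, _ => exact absurd hv ((hcross h).mp hu)
  | .cons h (.cons h' .nil), _ => exact ⟨_, h, h'.symm⟩
  | .cons h (.cons h' (.cons h'' .nil)), _ =>
    have := hcross h
    have := hcross h'
    have := hcross h''
    tauto
  | .cons _ (.cons _ (.cons _ (.cons _ _))), hle =>
    simp only [SimpleGraph.Walk.length_cons] at hle
    omega

/-- For `s ≥ 3` and `s-1 ≤ ρ ≤ s²-s-3`, there is no bipartite graph with parts `V1`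
(size `s²-1`, degrees `ρs`) and `V2` (size `ρ(s²-1)`, degrees `s`) of diameter 3; i.e., no
`[ρs,s;3]`-bigraph attains the Moore bound `M(ρs,s;3) = (s²-1)(ρ+1)`. -/
theorem stmt_7 {V : Type*} [Fintype V] (G : SimpleGraph V) [DecidableRel G.Adj]
    (V1 V2 : Finset V) (s ρ : ℕ) (hs : 3 ≤ s) (hρ1 : s - 1 ≤ ρ) (hρ2 : ρ ≤ s ^ 2 - s - 3)
    (hpart : ∀ v : V, v ∈ V1 ↔ v ∉ V2)
    (hbip : ∀ u v : V, G.Adj u v → (u ∈ V1 ∧ v ∈ V2) ∨ (u ∈ V2 ∧ v ∈ V1))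
    (hcard1 : V1.card = s ^ 2 - 1) (hcard2 : V2.card = ρ * (s ^ 2 - 1))
    (hdeg1 : ∀ v ∈ V1, G.degree v = ρ * s)
    (hdeg2 : ∀ v ∈ V2, G.degree v = s)
    (hdiam : G.diam = 3) :
    False := by
  classical
  have hρ : 0 < ρ := by omega
  have hs2 : 9 ≤ s ^ 2 := by nlinarith
  have hne : V2.Nonempty := by
    rw [← Finset.card_pos, hcard2]
    exact Nat.mul_pos hρ (by omega)
  have : Nonempty V2 := hne.to_subtype
  have hadj1 : ∀ b ∈ V2, ∀ a, G.Adj b a → a ∈ V1 := fun b hb a h => by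
    have := hbip b a h
    have := hpart b
    tauto
  have hadj2 : ∀ a ∈ V1, ∀ b, G.Adj a b → b ∈ V2 := fun a ha b h => by
    have := hbip a b h
    have := hpart a
    tauto
  have key := regular_intersecting_card_bound (α := V1) (β := V2)
    (fun b => Finset.univ.filter fun a => G.Adj b.1 a.1) s (ρ * s)
    (fun b => by
      rw [← hdeg2 b b.2, ← G.card_neighborFinset_eq_degree]
      refine Finset.card_bij (fun a _ => a.1) (by simp) (by simp) fun a ha => ?_
      rw [SimpleGraph.mem_neighborFinset] at ha
      exact ⟨⟨a, hadj1 b b.2 a ha⟩, by simpa using ha, rfl⟩)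
    (fun a => by
      rw [← hdeg1 a a.2, ← G.card_neighborFinset_eq_degree]
      refine Finset.card_bij (fun b _ => b.1) (by simp [G.adj_comm]) (by simp) fun b hb => ?_
      rw [SimpleGraph.mem_neighborFinset] at hb
      exact ⟨⟨b, hadj2 a a.2 b hb⟩, by simpa using hb.symm, rfl⟩)
    (fun b b' => by
      obtain ⟨x, hx, hx'⟩ : ∃ x, G.Adj b.1 x ∧ G.Adj b'.1 x := by
        by_cases h : b.1 = b'.1
        · have hpos : 0 < G.degree b.1 := by
            rw [hdeg2 b b.2]
            omega
          obtain ⟨x, hx⟩ := (G.degree_pos_iff_exists_adj b.1).mp hpos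
          exact ⟨x, hx, h ▸ hx⟩
        · exact exists_common_neighbor_of_diam_eq_three G V1 V2 hpart hbip hdiam b.2 b'.2 h
      exact ⟨⟨x, hadj1 b b.2 x hx⟩, by simp [hx, hx']⟩)
  rw [Fintype.card_coe, hcard1, Nat.cast_sub (by omega)] at key
  push_cast at key
  have hs' : (3 : ℝ) ≤ s := by exact_mod_cast hs
  nlinarith [mul_nonneg (sub_nonneg.mpr hs') (sq_nonneg (s : ℝ))]
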